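/- The incidence graph of the geometry with points the 2-element subsets of {1,...,6} and lines the perfect matchings of {1,...,6} is a connected bipartite 3-regular graph on 30 vertices. -/

import Mathlib

open scoped Classical

/-- A point: a 2-element subset of {1,...,6}. -/
def IsPointW2 (p : Finset (Fin 6)) : Prop := p.card = 2

/-- A line: a perfect matching of {1,...,6}. -/
def IsLineW2 (L : Finset (Finset (Fin 6))) : Prop :=
  L.card = 3 ∧ (∀ p ∈ L, p.card = 2) ∧ (∀ p ∈ L, ∀ q ∈ L, p ≠ q → Disjoint p q) ∧
    (∀ i : Fin 6, ∃ p ∈ L, i ∈ p)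

/-- Vertices of the incidence graph: points on the left, lines on the right. -/
abbrev VW2 := {p : Finset (Fin 6) // IsPointW2 p} ⊕ {L : Finset (Finset (Fin 6)) // IsLineW2 L}

/-- The incidence graph: a point-vertex and a line-vertex are adjacent iff the point belongs
to the line. -/
noncomputable def IncGraphW2 : SimpleGraph VW2 :=
  SimpleGraph.fromRel (fun x y =>
    match x, y with
    | Sum.inl p, Sum.inr L => p.1 ∈ L.1
    | _, _ => False)

/-- The points of the geometry, as an explicitly computable finset. -/
def pointsW2 : Finset (Finset (Fin 6)) := Finset.powersetCard 2 Finset.univ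

/-- The lines of the geometry, as an explicitly computable finset. -/
def linesW2 : Finset (Finset (Finset (Fin 6))) :=
  (Finset.powersetCard 3 pointsW2).filter fun L => ∀ i : Fin 6, ∃ p ∈ L, i ∈ p

theorem mem_pointsW2 {p : Finset (Fin 6)} : p ∈ pointsW2 ↔ IsPointW2 p := by
  simp [pointsW2, IsPointW2]

/-- Three pairs covering a six-element set are pairwise disjoint. -/
theorem pairwise_disjoint_of_mem_linesW2 {L : Finset (Finset (Fin 6))} (hL : L ∈ linesW2)
    {p q : Finset (Fin 6)} (hp : p ∈ L) (hq : q ∈ L) (hpq : p ≠ q) : Disjoint p q := by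
  simp only [linesW2, pointsW2, Finset.mem_filter, Finset.mem_powersetCard] at hL
  obtain ⟨⟨hsub, hcard⟩, hcov⟩ := hL
  have two {s} (hs : s ∈ L) : s.card = 2 := (Finset.mem_powersetCard.1 (hsub hs)).2
  have hq' : q ∈ L.erase p := Finset.mem_erase.2 ⟨hpq.symm, hq⟩
  obtain ⟨r, hr⟩ : ∃ r, (L.erase p).erase q = {r} := by
    rw [← Finset.card_eq_one, Finset.card_erase_of_mem hq', Finset.card_erase_of_mem hp, hcard]
  have hL : L = {p, q, r} := by
    rw [← Finset.insert_erase hp, ← Finset.insert_erase hq', hr]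
  have huniv : (Finset.univ : Finset (Fin 6)) ⊆ (p ∪ q) ∪ r := fun i _ => by
    obtain ⟨s, hs, his⟩ := hcov i
    rw [hL] at hs
    simp only [Finset.mem_insert, Finset.mem_singleton] at hs
    rcases hs with rfl | rfl | rfl <;> simp [his]
  have h6 := (Finset.card_le_card huniv).trans (Finset.card_union_le _ _)
  have hle := Finset.card_union_le p q
  rw [Finset.card_fin, two (show r ∈ L by simp [hL])] at h6
  rw [two hp, two hq] at hle
  rw [← Finset.card_union_eq_card_add_card, two hp, two hq]
  omega

theorem mem_linesW2 {L : Finset (Finset (Fin 6))} : L ∈ linesW2 ↔ IsLineW2 L := by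
  constructor
  · intro h
    have hd := @pairwise_disjoint_of_mem_linesW2 L h
    simp only [linesW2, Finset.mem_filter, Finset.mem_powersetCard] at h
    exact ⟨h.1.2, fun p hp => mem_pointsW2.1 (h.1.1 hp),
      fun p hp q hq => hd hp hq, h.2⟩
  · rintro ⟨hc, h2, -, hcov⟩
    simp only [linesW2, Finset.mem_filter, Finset.mem_powersetCard]
    exact ⟨⟨fun p hp => mem_pointsW2.2 (h2 p hp), hc⟩, hcov⟩

theorem card_pointsW2 : pointsW2.card = 15 := by
  simp [pointsW2, Nat.choose]

theorem card_linesW2 : linesW2.card = 15 := by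
  decide +kernel

theorem card_linesW2_through : ∀ p ∈ pointsW2, (linesW2.filter fun L => p ∈ L).card = 3 := by
  decide +kernel

/-- Any two points are collinear with a common third point. -/
theorem exists_linesW2_path : ∀ p ∈ pointsW2, ∀ q ∈ pointsW2,
    ∃ r ∈ pointsW2, (∃ L ∈ linesW2, p ∈ L ∧ r ∈ L) ∧ ∃ M ∈ linesW2, r ∈ M ∧ q ∈ M := by
  decide +kernel

theorem IncGraphW2_adj_inl_inr (p : {p : Finset (Fin 6) // IsPointW2 p})
    (L : {L : Finset (Finset (Fin 6)) // IsLineW2 L}) :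
    IncGraphW2.Adj (Sum.inl p) (Sum.inr L) ↔ p.1 ∈ L.1 := by
  simp [IncGraphW2]

theorem IncGraphW2_reachable_inl_inl (p q : {p : Finset (Fin 6) // IsPointW2 p}) :
    IncGraphW2.Reachable (Sum.inl p) (Sum.inl q) := by
  obtain ⟨r, hr, ⟨L, hL, hpL, hrL⟩, M, hM, hrM, hqM⟩ :=
    exists_linesW2_path p.1 (mem_pointsW2.2 p.2) q.1 (mem_pointsW2.2 q.2)
  have adj {s N} (hs : IsPointW2 s) (hN : N ∈ linesW2) (h : s ∈ N) :
      IncGraphW2.Adj (Sum.inl ⟨s, hs⟩) (Sum.inr ⟨N, mem_linesW2.1 hN⟩) :=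
    (IncGraphW2_adj_inl_inr _ _).2 h
  have hr' := mem_pointsW2.1 hr
  exact ((adj p.2 hL hpL).reachable.trans (adj hr' hL hrL).symm.reachable).trans
    ((adj hr' hM hrM).reachable.trans (adj q.2 hM hqM).symm.reachable)

theorem IncGraphW2_exists_reachable_inl (v : VW2) :
    ∃ p : {p : Finset (Fin 6) // IsPointW2 p}, IncGraphW2.Reachable (Sum.inl p) v := by
  rcases v with p | L
  · exact ⟨p, .rfl⟩
  · obtain ⟨p, hp, -⟩ := L.2.2.2.2 0
    exact ⟨⟨p, L.2.2.1 p hp⟩, ((IncGraphW2_adj_inl_inr _ _).2 hp).reachable⟩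

theorem IncGraphW2_connected : IncGraphW2.Connected := by
  have : Nonempty VW2 := ⟨Sum.inl ⟨{0, 1}, by simp [IsPointW2]⟩⟩
  refine ⟨fun v w => ?_⟩
  obtain ⟨p, hp⟩ := IncGraphW2_exists_reachable_inl v
  obtain ⟨q, hq⟩ := IncGraphW2_exists_reachable_inl w
  exact hp.symm.trans ((IncGraphW2_reachable_inl_inl p q).trans hq)

theorem IncGraphW2_colorable : IncGraphW2.Colorable 2 := by
  refine ⟨SimpleGraph.Coloring.mk (Sum.elim (fun _ => 0) fun _ => 1) ?_⟩
  rintro (p | L) (q | M) h <;> simp [IncGraphW2] at h ⊢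

theorem IncGraphW2_degree (v : VW2) : IncGraphW2.degree v = 3 := by
  rw [← SimpleGraph.card_neighborFinset_eq_degree]
  rcases v with p | L
  · rw [← card_linesW2_through p.1 (mem_pointsW2.2 p.2)]
    refine (Finset.card_bij (fun L hL => Sum.inr ⟨L, mem_linesW2.1 (Finset.mem_filter.1 hL).1⟩)
      ?_ ?_ ?_).symm
    · intro L hL
      simpa [IncGraphW2_adj_inl_inr] using (Finset.mem_filter.1 hL).2
    · intro L _ M _ h
      simpa using h
    · intro w h
      rw [SimpleGraph.mem_neighborFinset] at h
      rcases w with q | L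
      · simp [IncGraphW2] at h
      · exact ⟨L.1, Finset.mem_filter.2 ⟨mem_linesW2.2 L.2, (IncGraphW2_adj_inl_inr _ _).1 h⟩, rfl⟩
  · rw [← L.2.1]
    refine (Finset.card_bij (fun p hp => Sum.inl ⟨p, L.2.2.1 p hp⟩) ?_ ?_ ?_).symm
    · intro p hp
      rw [SimpleGraph.mem_neighborFinset]
      exact ((IncGraphW2_adj_inl_inr _ _).2 hp).symm
    · intro p _ q _ h
      exact congrArg Subtype.val (Sum.inl.inj h)
    · intro w h
      rw [SimpleGraph.mem_neighborFinset] at h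
      rcases w with p | M
      · exact ⟨p.1, (IncGraphW2_adj_inl_inr _ _).1 h.symm, rfl⟩
      · simp [IncGraphW2] at h

theorem card_VW2 : Fintype.card VW2 = 30 := by
  rw [Fintype.card_sum, Fintype.card_of_subtype pointsW2 fun _ => mem_pointsW2,
    Fintype.card_of_subtype linesW2 fun _ => mem_linesW2, card_pointsW2, card_linesW2]

/-- The incidence graph of W(2) is a connected bipartite 3-regular graph on 30 vertices. -/
theorem IncGraphW2_connected_bipartite_cubic_30 :
    IncGraphW2.Connected ∧ IncGraphW2.Colorable 2 ∧
    (∀ v : VW2, IncGraphW2.degree v = 3) ∧ Fintype.card VW2 = 30 :=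
  ⟨IncGraphW2_connected, IncGraphW2_colorable, IncGraphW2_degree, card_VW2⟩
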